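/- Let n, m ≥ 0 and let X^{i₁…i_n}(q) and Y^{j₁…j_m}(q) be the smooth, index-symmetric coefficient functions on ℝ^d of symmetric contravariant tensor fields X and Y of orders n and m, and set H_X(q,p) = Σ_{i₁,…,i_n} X^{i₁…i_n}(q) p_{i₁}⋯p_{i_n} and similarly H_Y on ℝ^d × ℝ^d. Then the canonical Poisson bracket satisfies {H_X, H_Y} = −H_Z, where Z is the Schouten concomitant [X,Y]_SC of order n+m−1 with coefficients Z^{i₁…i_{n+m−1}} = n·Σ_l X^{i_{m+1}…i_{m+n−1} l} ∂Y^{i₁…i_m}/∂q^l − m·Σ_l Y^{i_{n+1}…i_{n+m−1} l} ∂X^{i₁…i_n}/∂q^l, and H_Z(q,p) = Σ Z^{i₁…i_{n+m−1}}(q) p_{i₁}⋯p_{i_{n+m−1}}. That is, the map X ↦ H_X is a Lie algebra anti-homomorphism from the Schouten bracket to the canonical Poisson bracket. -/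

import Mathlib

noncomputable section

/-- The fiberwise-polynomial function `H_X(q,p) = Σ_ι X^ι(q) p_{ι 0} ⋯ p_{ι (n-1)}`
determined by the coefficients of an order-`n` contravariant tensor field on `ℝ^d`. -/
def Hfun (d n : ℕ) (X : (Fin d → ℝ) → (Fin n → Fin d) → ℝ)
    (z : (Fin d → ℝ) × (Fin d → ℝ)) : ℝ :=
  ∑ ι : Fin n → Fin d, X z.1 ι * ∏ k, z.2 (ι k)

/-- Canonical Poisson bracket `{f,g} = ∇_q f·∇_p g − ∇_p f·∇_q g` on `ℝ^d × ℝ^d`. -/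
def poisson (d : ℕ) (f g : (Fin d → ℝ) × (Fin d → ℝ) → ℝ)
    (z : (Fin d → ℝ) × (Fin d → ℝ)) : ℝ :=
  (∑ l, fderiv ℝ f z (Pi.single l 1, 0) * fderiv ℝ g z (0, Pi.single l 1)) -
  (∑ l, fderiv ℝ f z (0, Pi.single l 1) * fderiv ℝ g z (Pi.single l 1, 0))

/-- The Schouten concomitant `[X,Y]_SC` of symmetric contravariant tensor fields of
orders `n` and `m`, an order `n+m−1` tensor field with coefficients
`Z^{i₁…i_{n+m−1}} = n Σ_l X^{i_{m+1}…i_{m+n−1} l} ∂_l Y^{i₁…i_m}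
 − m Σ_l Y^{i_{n+1}…i_{n+m−1} l} ∂_l X^{i₁…i_n}`. -/
def schouten (d n m : ℕ) (X : (Fin d → ℝ) → (Fin n → Fin d) → ℝ)
    (Y : (Fin d → ℝ) → (Fin m → Fin d) → ℝ) :
    (Fin d → ℝ) → (Fin (n + m - 1) → Fin d) → ℝ := fun q ι =>
  (n : ℝ) * ∑ l : Fin d,
      X q (fun k => if h : m + (k : ℕ) < n + m - 1 then ι ⟨m + (k : ℕ), h⟩ else l) *
        fderiv ℝ
          (fun q' => Y q' (fun k => if h : (k : ℕ) < n + m - 1 then ι ⟨(k : ℕ), h⟩ else l))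
          q (Pi.single l 1)
  - (m : ℝ) * ∑ l : Fin d,
      Y q (fun k => if h : n + (k : ℕ) < n + m - 1 then ι ⟨n + (k : ℕ), h⟩ else l) *
        fderiv ℝ
          (fun q' => X q' (fun k => if h : (k : ℕ) < n + m - 1 then ι ⟨(k : ℕ), h⟩ else l))
          q (Pi.single l 1)

/-- The differential of `H_X` at `z`, evaluated at a tangent vector `v`. -/
lemma fderiv_Hfun_apply {d n : ℕ} {X : (Fin d → ℝ) → (Fin n → Fin d) → ℝ}
    (hX : ∀ ι, Differentiable ℝ (fun q => X q ι)) (z v : (Fin d → ℝ) × (Fin d → ℝ)) :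
    fderiv ℝ (Hfun d n X) z v =
      ∑ ι : Fin n → Fin d, (X z.1 ι * ∑ k, (∏ j ∈ Finset.univ.erase k, z.2 (ι j)) * v.2 (ι k) +
        (∏ k, z.2 (ι k)) * fderiv ℝ (fun q => X q ι) z.1 v.1) := by
  have hp (i : Fin d) : HasFDerivAt (fun w : (Fin d → ℝ) × (Fin d → ℝ) => w.2 i)
      ((ContinuousLinearMap.proj (R := ℝ) (φ := fun _ : Fin d => ℝ) i).comp
        (ContinuousLinearMap.snd ℝ (Fin d → ℝ) (Fin d → ℝ))) z :=
    ((ContinuousLinearMap.proj (R := ℝ) (φ := fun _ : Fin d => ℝ) i).comp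
      (ContinuousLinearMap.snd ℝ (Fin d → ℝ) (Fin d → ℝ))).hasFDerivAt
  have hprod (ι : Fin n → Fin d) :=
    HasFDerivAt.finsetProd (u := Finset.univ) (fun k _ => hp (ι k))
  have hq (ι : Fin n → Fin d) : HasFDerivAt (fun w : (Fin d → ℝ) × (Fin d → ℝ) => X w.1 ι)
      ((fderiv ℝ (fun q => X q ι) z.1).comp
        (ContinuousLinearMap.fst ℝ (Fin d → ℝ) (Fin d → ℝ))) z :=
    HasFDerivAt.comp z (hX ι z.1).hasFDerivAt hasFDerivAt_fst
  have h : HasFDerivAt (Hfun d n X) _ z :=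
    HasFDerivAt.fun_sum (u := Finset.univ) (fun ι _ => (hq ι).mul (hprod ι))
  rw [h.fderiv]
  simp

lemma fderiv_Hfun_apply_left {d n : ℕ} {X : (Fin d → ℝ) → (Fin n → Fin d) → ℝ}
    (hX : ∀ ι, Differentiable ℝ (fun q => X q ι)) (z : (Fin d → ℝ) × (Fin d → ℝ))
    (v : Fin d → ℝ) :
    fderiv ℝ (Hfun d n X) z (v, 0) =
      ∑ ι : Fin n → Fin d, fderiv ℝ (fun q => X q ι) z.1 v * ∏ k, z.2 (ι k) := by
  rw [fderiv_Hfun_apply hX]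
  simp [mul_comm]

/-- For symmetric `X`, the derivative of `H_X` in the direction `p_l` is obtained by filling one
slot of `X` with the index `l`. -/
lemma fderiv_Hfun_apply_right_single {d n : ℕ} {X : (Fin d → ℝ) → (Fin (n + 1) → Fin d) → ℝ}
    (hX : ∀ ι, Differentiable ℝ (fun q => X q ι))
    (hsymm : ∀ q (σ : Equiv.Perm (Fin (n + 1))) ι, X q (ι ∘ σ) = X q ι)
    (z : (Fin d → ℝ) × (Fin d → ℝ)) (l : Fin d) :
    fderiv ℝ (Hfun d (n + 1) X) z (0, Pi.single l 1) =
      ((n + 1 : ℕ) : ℝ) *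
        ∑ κ : Fin n → Fin d, X z.1 (Fin.snoc (α := fun _ => Fin d) κ l) * ∏ k, z.2 (κ k) := by
  have hlast : ∑ ι : Fin (n + 1) → Fin d, X z.1 ι *
        ((∏ j ∈ Finset.univ.erase (Fin.last n), z.2 (ι j)) *
          (Pi.single l 1 : Fin d → ℝ) (ι (Fin.last n))) =
      ∑ κ : Fin n → Fin d, X z.1 (Fin.snoc (α := fun _ => Fin d) κ l) * ∏ k, z.2 (κ k) := by
    rw [← (Fin.snocEquiv fun _ : Fin (n + 1) => Fin d).sum_comp, Fintype.sum_prod_type_right]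
    refine Finset.sum_congr rfl fun κ _ => ?_
    have herase : Finset.univ.erase (Fin.last n) = Finset.univ.map Fin.castSuccEmb := by
      ext j
      induction j using Fin.lastCases <;> simp
    simp [Fin.snocEquiv, herase, Pi.single_apply]
  have hslot (k : Fin (n + 1)) : ∑ ι : Fin (n + 1) → Fin d, X z.1 ι *
        ((∏ j ∈ Finset.univ.erase k, z.2 (ι j)) * (Pi.single l 1 : Fin d → ℝ) (ι k)) =
      ∑ κ : Fin n → Fin d, X z.1 (Fin.snoc (α := fun _ => Fin d) κ l) * ∏ k, z.2 (κ k) := by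
    rw [← hlast, ← ((Equiv.swap k (Fin.last n)).arrowCongr (Equiv.refl (Fin d))).sum_comp]
    refine Finset.sum_congr rfl fun ι _ => ?_
    have hι : (Equiv.swap k (Fin.last n)).arrowCongr (Equiv.refl (Fin d)) ι =
        ι ∘ Equiv.swap k (Fin.last n) := rfl
    rw [hι, hsymm]
    congr 2
    · refine Finset.prod_equiv (Equiv.swap k (Fin.last n)) (fun j => ?_) fun j _ => rfl
      simp [Equiv.swap_apply_eq_iff]
    · simp
  rw [fderiv_Hfun_apply hX]
  simp only [map_zero, mul_zero, add_zero, Finset.mul_sum (s := (Finset.univ : Finset (Fin _)))]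
  rw [Finset.sum_comm, Finset.sum_congr rfl fun k _ => hslot k]
  simp

/-- A product of two homogeneous polynomials in `p`, as a sum over concatenated multi-indices. -/
lemma sum_mul_sum_prod_append {d n m : ℕ} (A : (Fin n → Fin d) → ℝ) (B : (Fin m → Fin d) → ℝ)
    (p : Fin d → ℝ) :
    (∑ κ, A κ * ∏ k, p (κ k)) * ∑ κ, B κ * ∏ k, p (κ k) =
      ∑ ι : Fin (m + n) → Fin d,
        A (fun k => ι (Fin.natAdd m k)) * B (fun k => ι (Fin.castAdd n k)) * ∏ k, p (ι k) := by
  rw [← (Fin.appendEquiv m n).sum_comp, Fintype.sum_prod_type_right, Finset.sum_mul_sum]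
  refine Finset.sum_congr rfl fun κ _ => Finset.sum_congr rfl fun μ _ => ?_
  simp only [Fin.appendEquiv, Equiv.coe_fn_mk, Fin.append_left, Fin.append_right,
    Fin.prod_univ_add]
  ring

lemma fderiv_Hfun_single_mul_sum {d n m T : ℕ} (hT : T = n + m - 1)
    {X : (Fin d → ℝ) → (Fin n → Fin d) → ℝ}
    (hX : ∀ ι, Differentiable ℝ (fun q => X q ι))
    (hsymm : ∀ q (σ : Equiv.Perm (Fin n)) ι, X q (ι ∘ σ) = X q ι)
    (B : (Fin m → Fin d) → ℝ) (z : (Fin d → ℝ) × (Fin d → ℝ)) (l : Fin d) :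
    fderiv ℝ (Hfun d n X) z (0, Pi.single l 1) * ∑ κ, B κ * ∏ k, z.2 (κ k) =
      (n : ℝ) * ∑ ι : Fin T → Fin d,
        X z.1 (fun k => if h : m + (k : ℕ) < T then ι ⟨m + (k : ℕ), h⟩ else l) *
          B (fun k => if h : (k : ℕ) < T then ι ⟨(k : ℕ), h⟩ else l) * ∏ k, z.2 (ι k) := by
  cases n with
  | zero => simp [fderiv_Hfun_apply hX]
  | succ n =>
    obtain rfl : T = m + n := by omega
    rw [fderiv_Hfun_apply_right_single hX hsymm, mul_assoc, sum_mul_sum_prod_append]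
    congr 1
    refine Finset.sum_congr rfl fun ι _ => ?_
    congr 3
    · ext1 k
      induction k using Fin.lastCases with
      | last => simp
      | cast k =>
        simp only [Fin.snoc_castSucc, Fin.val_castSucc, add_lt_add_iff_left, k.isLt, dite_true]
        rfl
    · ext1 k
      rw [dif_pos (by omega)]
      rfl

/-- `X ↦ H_X` is a Lie algebra anti-homomorphism from the Schouten bracket to the
canonical Poisson bracket: `{H_X, H_Y} = −H_{[X,Y]_SC}`. -/
theorem stmt11 (d n m : ℕ)
    (X : (Fin d → ℝ) → (Fin n → Fin d) → ℝ) (Y : (Fin d → ℝ) → (Fin m → Fin d) → ℝ)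
    (hX : ∀ ι, ContDiff ℝ (⊤ : ℕ∞) (fun q => X q ι)) (hY : ∀ ι, ContDiff ℝ (⊤ : ℕ∞) (fun q => Y q ι))
    (hXsymm : ∀ q (σ : Equiv.Perm (Fin n)) ι, X q (ι ∘ σ) = X q ι)
    (hYsymm : ∀ q (σ : Equiv.Perm (Fin m)) ι, Y q (ι ∘ σ) = Y q ι) :
    ∀ z, poisson d (Hfun d n X) (Hfun d m Y) z
      = -(Hfun d (n + m - 1) (schouten d n m X Y) z) := by
  intro z
  have hX' ι := (hX ι).differentiable (by simp)
  have hY' ι := (hY ι).differentiable (by simp)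
  simp only [poisson, fderiv_Hfun_apply_left hX', fderiv_Hfun_apply_left hY']
  simp_rw [mul_comm (∑ ι : Fin n → Fin d, _) (fderiv ℝ _ z _)]
  simp_rw [fderiv_Hfun_single_mul_sum (T := n + m - 1) rfl hX' hXsymm,
    fderiv_Hfun_single_mul_sum (show n + m - 1 = m + n - 1 by rw [add_comm]) hY' hYsymm]
  simp only [Hfun, schouten, sub_mul, Finset.sum_sub_distrib, neg_sub, Finset.mul_sum,
    Finset.sum_mul, mul_assoc]
  congr 1 <;> exact Finset.sum_comm
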